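/- Let n be even, let W(i) := (n − 2i)(n + 2 − 2i)/(2n) for i ∈ {0,1,…,n/2}, let π(i) = (C(n,i) − C(n,i−1))/C(n, n/2) for 1 ≤ i ≤ n/2 and π(0) = 1/C(n, n/2), and let K be the birth-death transition matrix on {0,1,…,n/2} with K(i,i+1) := (n−i+1)/(n(n−2i)(n−2i+1)) for i < n/2, K(n/2, n/2+1) := 0, K(i,i−1) := i/(n(n−2i+1)(n−2i+2)), and K(i,i) := 1 − K(i,i+1) − K(i,i−1). For each i and each positive integer m write M_m(i) := Σ_j K(i,j)·(W(j) − W(i))^m (the m-th conditional moment of the increment given i). Then: (1) M₁(i) = −2/n² for all i < n/2, and M₁(n/2) = 1/n; (2) Σ_i π(i)·W(i) = 1; (3) M₂(i) = 4/n² for all i; (4) M₄(i) = (32/n³ − 64/n⁴)·W(i) + 64/n⁴ for all i; (5) Σ_i π(i)·M₄(i) = 32/n³. -/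

import Mathlib

open Finset

/-- The spectral measure of the Bernoulli-Laplace chain. -/
noncomputable def piBL (n i : ℕ) : ℝ :=
  if i = 0 then 1 / (n.choose (n / 2) : ℝ)
  else ((n.choose i : ℝ) - (n.choose (i - 1) : ℝ)) / (n.choose (n / 2) : ℝ)

/-- The rescaled eigenvalue `W(i) = (n-2i)(n+2-2i)/(2n)`. -/
noncomputable def WBL (n i : ℕ) : ℝ :=
  ((n : ℝ) - 2 * i) * ((n : ℝ) + 2 - 2 * i) / (2 * n)

/-- Up-transition probability of the first birth-death chain:
`K(i,i+1) = (n-i+1)/(n(n-2i)(n-2i+1))` for `i < n/2`, and `K(n/2, n/2+1) = 0`. -/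
noncomputable def upBL (n i : ℕ) : ℝ :=
  if i < n / 2 then ((n : ℝ) - i + 1) / ((n : ℝ) * ((n : ℝ) - 2 * i) * ((n : ℝ) - 2 * i + 1))
  else 0

/-- Down-transition probability: `K(i,i-1) = i/(n(n-2i+1)(n-2i+2))`. -/
noncomputable def downBL (n i : ℕ) : ℝ :=
  (i : ℝ) / ((n : ℝ) * ((n : ℝ) - 2 * i + 1) * ((n : ℝ) - 2 * i + 2))

/-- The birth-death transition matrix of Subsection 4.1. -/
noncomputable def KBL (n i j : ℕ) : ℝ :=
  if j = i + 1 then upBL n i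
  else if i = j + 1 then downBL n i
  else if i = j then 1 - upBL n i - downBL n i
  else 0

/-- `M_m(i) = Σ_j K(i,j) (W(j) - W(i))^m`, the `m`-th conditional moment of the increment. -/
noncomputable def MBL (n m i : ℕ) : ℝ :=
  ∑ j ∈ Finset.range (n / 2 + 1), KBL n i j * (WBL n j - WBL n i) ^ m

theorem downBL_zero (n : ℕ) : downBL n 0 = 0 := by simp [downBL]

theorem upBL_of_not_lt {n i : ℕ} (h : ¬ i < n / 2) : upBL n i = 0 := by simp [upBL, h]

/-- Only the two neighbours of `i` contribute to the moments of the increment. -/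
theorem MBL_eq_up_add_down {n m i : ℕ} (hm : m ≠ 0) (hi : i ≤ n / 2) :
    MBL n m i = upBL n i * (WBL n (i + 1) - WBL n i) ^ m
      + downBL n i * (WBL n (i - 1) - WBL n i) ^ m := by
  have key : ∀ j, KBL n i j * (WBL n j - WBL n i) ^ m =
      (if j = i + 1 then upBL n i * (WBL n j - WBL n i) ^ m else 0)
        + (if j = i - 1 then downBL n i * (WBL n j - WBL n i) ^ m else 0) := by
    intro j
    unfold KBL
    rcases Nat.eq_zero_or_pos i with rfl | hi0
    · by_cases h1 : j = 0 + 1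
      · subst h1; simp
      · by_cases h2 : j = 0
        · subst h2; simp [hm]
        · simp [downBL_zero, Ne.symm h2, h1]
    · by_cases h1 : j = i + 1
      · have h2 : j ≠ i - 1 := by omega
        simp only [if_pos h1, if_neg h2, add_zero]
      · by_cases h2 : j = i - 1
        · have h3 : i = j + 1 := by omega
          simp only [if_neg h1, if_pos h2, if_pos h3, zero_add]
        · have h3 : i ≠ j + 1 := by omega
          by_cases h4 : i = j
          · subst h4; simp [hm, h2]
          · simp [h1, h2, h3, h4]
  have hdown : i - 1 < n / 2 + 1 := by omega
  simp only [MBL, key, sum_add_distrib, sum_ite_eq', mem_range, if_pos hdown]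
  congr 1
  split_ifs with h
  · rfl
  · rw [upBL_of_not_lt (by omega), zero_mul]

theorem WBL_succ_sub (n i : ℕ) :
    WBL n (i + 1) - WBL n i = -2 * ((n : ℝ) - 2 * i) / n := by
  simp only [WBL]
  push_cast
  ring

theorem downBL_mul_pow (n m i : ℕ) :
    downBL n i * (WBL n (i - 1) - WBL n i) ^ m
      = downBL n i * (2 * ((n : ℝ) - 2 * i + 2) / n) ^ m := by
  cases i with
  | zero => simp [downBL_zero]
  | succ i =>
    simp only [WBL, Nat.add_sub_cancel]
    push_cast
    ring

theorem exists_pos_eq_of_lt_half {n i : ℕ} (hi : i < n / 2) :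
    ∃ a : ℝ, 0 < a ∧ (i : ℝ) = (n - a) / 2 := by
  have h : (2 * i : ℝ) < n := by exact_mod_cast (by omega : 2 * i < n)
  exact ⟨n - 2 * i, by linarith, by ring⟩

theorem MBL_of_lt {n m i : ℕ} {a : ℝ} (hm : m ≠ 0) (hi : i < n / 2)
    (ha : (i : ℝ) = (n - a) / 2) :
    MBL n m i = (n + a + 2) / (2 * n * a * (a + 1)) * (-2 * a / n) ^ m
      + (n - a) / (2 * n * (a + 1) * (a + 2)) * (2 * (a + 2) / n) ^ m := by
  rw [MBL_eq_up_add_down hm hi.le, WBL_succ_sub, downBL_mul_pow, upBL, if_pos hi, downBL, ha,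
    show (n : ℝ) - 2 * ((n - a) / 2) = a by ring,
    show (n : ℝ) - (n - a) / 2 + 1 = (n + a + 2) / 2 by ring]
  simp only [div_div, mul_assoc]

theorem MBL_half {n m : ℕ} (hn : Even n) (hm : m ≠ 0) :
    MBL n m (n / 2) = 1 / 4 * (4 / (n : ℝ)) ^ m := by
  rcases Nat.eq_zero_or_pos n with rfl | hpos
  · simp [MBL, hm]
  have hc : ((n / 2 : ℕ) : ℝ) = n / 2 := Nat.cast_div_charZero hn.two_dvd
  have hn0 : (n : ℝ) ≠ 0 := by positivity
  rw [MBL_eq_up_add_down hm le_rfl, downBL_mul_pow, upBL_of_not_lt (lt_irrefl _), downBL, hc,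
    show (n : ℝ) - 2 * (n / 2) = 0 by ring]
  field_simp
  ring

theorem MBL_one_of_lt {n i : ℕ} (hi : i < n / 2) : MBL n 1 i = -2 / (n : ℝ) ^ 2 := by
  obtain ⟨a, ha0, ha⟩ := exists_pos_eq_of_lt_half hi
  have hn0 : (n : ℝ) ≠ 0 := Nat.cast_ne_zero.2 (by omega)
  rw [MBL_of_lt one_ne_zero hi ha]
  field_simp
  ring

theorem MBL_two {n i : ℕ} (hn : Even n) (hi : i ≤ n / 2) : MBL n 2 i = 4 / (n : ℝ) ^ 2 := by
  rcases hi.eq_or_lt with rfl | hi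
  · rw [MBL_half hn two_ne_zero]
    ring
  obtain ⟨a, ha0, ha⟩ := exists_pos_eq_of_lt_half hi
  have hn0 : (n : ℝ) ≠ 0 := Nat.cast_ne_zero.2 (by omega)
  rw [MBL_of_lt two_ne_zero hi ha]
  field_simp
  ring

theorem WBL_half {n : ℕ} (hn : Even n) : WBL n (n / 2) = 0 := by
  have hc : ((n / 2 : ℕ) : ℝ) = n / 2 := Nat.cast_div_charZero hn.two_dvd
  rw [WBL, hc]
  ring

theorem MBL_four {n i : ℕ} (hn : Even n) (hi : i ≤ n / 2) :
    MBL n 4 i = (32 / (n : ℝ) ^ 3 - 64 / (n : ℝ) ^ 4) * WBL n i + 64 / (n : ℝ) ^ 4 := by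
  rcases hi.eq_or_lt with rfl | hi
  · rw [MBL_half hn four_ne_zero, WBL_half hn]
    ring
  obtain ⟨a, ha0, ha⟩ := exists_pos_eq_of_lt_half hi
  have hn0 : (n : ℝ) ≠ 0 := Nat.cast_ne_zero.2 (by omega)
  rw [MBL_of_lt four_ne_zero hi ha, WBL, ha]
  field_simp
  ring

theorem sum_piBL_range (n k : ℕ) :
    ∑ i ∈ range (k + 1), piBL n i = (n.choose k : ℝ) / n.choose (n / 2) := by
  induction k with
  | zero => simp [piBL]
  | succ k ih =>
    rw [sum_range_succ, ih, piBL, if_neg k.succ_ne_zero, Nat.add_sub_cancel]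
    ring

theorem sum_piBL {n : ℕ} : ∑ i ∈ range (n / 2 + 1), piBL n i = 1 := by
  have h : (n.choose (n / 2) : ℝ) ≠ 0 :=
    Nat.cast_ne_zero.2 (Nat.choose_pos (Nat.div_le_self n 2)).ne'
  rw [sum_piBL_range, div_self h]

theorem sum_piBL_mul_WBL_range {n k : ℕ} (hpos : 0 < n) (hk : k ≤ n) :
    ∑ i ∈ range (k + 1), piBL n i * WBL n i
      = (n.choose k : ℝ) / n.choose (n / 2) * (WBL n k + 2 * k / n) := by
  induction k with
  | zero => simp [piBL]
  | succ k ih =>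
    have hn0 : (n : ℝ) ≠ 0 := by positivity
    have h : (n.choose (n / 2) : ℝ) ≠ 0 :=
      Nat.cast_ne_zero.2 (Nat.choose_pos (Nat.div_le_self n 2)).ne'
    have hc : (n.choose (k + 1) : ℝ) * (k + 1) = n.choose k * (n - k) := by
      rw [← Nat.cast_sub (by omega : k ≤ n)]
      exact_mod_cast Nat.choose_succ_right_eq n k
    rw [sum_range_succ, ih (by omega), piBL, if_neg k.succ_ne_zero, Nat.add_sub_cancel,
      eq_add_of_sub_eq' (WBL_succ_sub n k)]
    push_cast
    field_simp
    linear_combination -2 * hc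

theorem sum_piBL_mul_WBL {n : ℕ} (hn : Even n) (hpos : 0 < n) :
    ∑ i ∈ range (n / 2 + 1), piBL n i * WBL n i = 1 := by
  have hn0 : (n : ℝ) ≠ 0 := by positivity
  have h : (n.choose (n / 2) : ℝ) ≠ 0 :=
    Nat.cast_ne_zero.2 (Nat.choose_pos (Nat.div_le_self n 2)).ne'
  have hc : ((n / 2 : ℕ) : ℝ) = n / 2 := Nat.cast_div_charZero hn.two_dvd
  rw [sum_piBL_mul_WBL_range hpos (Nat.div_le_self n 2), WBL_half hn, hc]
  field_simp
  norm_num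

/-- Lemma 4.2 (momcom): moment computations for the exchangeable pair of Subsection 4.1. -/
theorem moment_computations_v1 (n : ℕ) (hn : Even n) (hpos : 0 < n) :
    (∀ i < n / 2, MBL n 1 i = -2 / (n : ℝ) ^ 2) ∧
    MBL n 1 (n / 2) = 1 / (n : ℝ) ∧
    (∑ i ∈ Finset.range (n / 2 + 1), piBL n i * WBL n i = 1) ∧
    (∀ i ≤ n / 2, MBL n 2 i = 4 / (n : ℝ) ^ 2) ∧
    (∀ i ≤ n / 2, MBL n 4 i = (32 / (n : ℝ) ^ 3 - 64 / (n : ℝ) ^ 4) * WBL n i + 64 / (n : ℝ) ^ 4) ∧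
    (∑ i ∈ Finset.range (n / 2 + 1), piBL n i * MBL n 4 i = 32 / (n : ℝ) ^ 3) := by
  refine ⟨fun i hi => MBL_one_of_lt hi, ?_, sum_piBL_mul_WBL hn hpos,
    fun i hi => MBL_two hn hi, fun i hi => MBL_four hn hi, ?_⟩
  · rw [MBL_half hn one_ne_zero]
    ring
  · have h : ∀ i ∈ range (n / 2 + 1), piBL n i * MBL n 4 i =
        (32 / (n : ℝ) ^ 3 - 64 / (n : ℝ) ^ 4) * (piBL n i * WBL n i)
          + 64 / (n : ℝ) ^ 4 * piBL n i := fun i hi => by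
      rw [MBL_four hn (Nat.lt_succ_iff.1 (mem_range.1 hi))]
      ring
    rw [sum_congr rfl h, sum_add_distrib, ← mul_sum, ← mul_sum, sum_piBL_mul_WBL hn hpos,
      sum_piBL]
    ring
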